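/- Let Y1, Y0, X be compact metric spaces with Borel σ-algebras, μ1X and μ0X Borel probability measures on Y1 × X and Y0 × X with the same X-marginal, m1 : Y0 × X → (d_θ × d_θ real matrices) continuous, m2 : Y1 × Y0 × X → ℝ^{d_θ} continuous, with A := ∫ m1 dμ0X invertible. Define s(q) := − inf over μ ∈ M(μ1X, μ0X) of ∫ qᵀ A⁻¹ m2(y1, y0, x) dμ, and let Θ_I := {θ ∈ ℝ^{d_θ} : there exists μ ∈ M(μ1X, μ0X) with ∫ (m1(y0, x) θ + m2(y1, y0, x)) dμ = 0}. Then for every q in the unit sphere of ℝ^{d_θ} there exists θ ∈ Θ_I such that ⟨q, θ⟩ = s(q) (the Tight Bounds Lemma of the appendix). -/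

import Mathlib

open MeasureTheory
open scoped RealInnerProductSpace

/-- The set `M(μ1X, μ0X)` of probability measures on `Y1 × Y0 × X` whose projection on
`(Y1, X)` is `μ1X` and whose projection on `(Y0, X)` is `μ0X`. -/
def MSet {Y1 Y0 X : Type*} [MeasurableSpace Y1] [MeasurableSpace Y0] [MeasurableSpace X]
    (μ1X : Measure (Y1 × X)) (μ0X : Measure (Y0 × X)) :
    Set (Measure (Y1 × Y0 × X)) :=
  {μ | IsProbabilityMeasure μ ∧
    μ.map (fun p => (p.1, p.2.2)) = μ1X ∧ μ.map (fun p => (p.2.1, p.2.2)) = μ0X}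

open ProbabilityTheory in
/-- Gluing: the set of couplings is nonempty. -/
lemma MSet_nonempty_aux
    {Y1 Y0 X : Type*}
    [MeasurableSpace Y1] [StandardBorelSpace Y1] [Nonempty Y1]
    [MeasurableSpace Y0] [StandardBorelSpace Y0] [Nonempty Y0]
    [MeasurableSpace X]
    (μ1X : Measure (Y1 × X)) (μ0X : Measure (Y0 × X))
    [IsProbabilityMeasure μ1X] [IsProbabilityMeasure μ0X]
    (hmarg : μ1X.map Prod.snd = μ0X.map Prod.snd) : (MSet μ1X μ0X).Nonempty := by
  let ρ1 := μ1X.map Prod.swap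
  let ρ0 := μ0X.map Prod.swap
  haveI : IsProbabilityMeasure ρ1 := Measure.isProbabilityMeasure_map measurable_swap.aemeasurable
  haveI : IsProbabilityMeasure ρ0 := Measure.isProbabilityMeasure_map measurable_swap.aemeasurable
  have h1 : ρ1.fst = μ1X.map Prod.snd := by
    simp only [ρ1, Measure.fst]
    rw [Measure.map_map measurable_fst measurable_swap]; rfl
  have h0 : ρ0.fst = μ1X.map Prod.snd := by
    rw [hmarg]
    simp only [ρ0, Measure.fst]
    rw [Measure.map_map measurable_fst measurable_swap]; rfl
  have d1 : ρ1.fst ⊗ₘ ρ1.condKernel = ρ1 := ρ1.disintegrate ρ1.condKernel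
  have d0 : ρ0.fst ⊗ₘ ρ0.condKernel = ρ0 := ρ0.disintegrate ρ0.condKernel
  rw [h1] at d1
  rw [h0] at d0
  set ν := μ1X.map Prod.snd with hν
  haveI : IsProbabilityMeasure ν := Measure.isProbabilityMeasure_map measurable_snd.aemeasurable
  let τ := ν ⊗ₘ (ρ1.condKernel ×ₖ ρ0.condKernel)
  have e1 : τ.map (Prod.map id Prod.fst) = ρ1 := by
    rw [← d1, ← Measure.compProd_map measurable_fst, ← Kernel.fst_eq, Kernel.fst_prod]
  have e0 : τ.map (Prod.map id Prod.snd) = ρ0 := by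
    rw [← d0, ← Measure.compProd_map measurable_snd, ← Kernel.snd_eq, Kernel.snd_prod]
  have hg : Measurable (fun p : X × (Y1 × Y0) => (p.2.1, p.2.2, p.1)) := by fun_prop
  refine ⟨τ.map (fun p => (p.2.1, p.2.2, p.1)), ?_, ?_, ?_⟩
  · exact Measure.isProbabilityMeasure_map hg.aemeasurable
  · rw [Measure.map_map (by fun_prop) hg]
    have : ρ1.map Prod.swap = μ1X := by
      simp only [ρ1]
      rw [Measure.map_map measurable_swap measurable_swap]; simp
    rw [← this, ← e1, Measure.map_map measurable_swap (by fun_prop)]; rfl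
  · rw [Measure.map_map (by fun_prop) hg]
    have : ρ0.map Prod.swap = μ0X := by
      simp only [ρ0]
      rw [Measure.map_map measurable_swap measurable_swap]; simp
    rw [← this, ← e0, Measure.map_map measurable_swap (by fun_prop)]; rfl

/-- A continuous cost attains its minimum on a nonempty set of couplings. -/
lemma MSet_exists_min_aux
    {Y1 Y0 X : Type*}
    [MetricSpace Y1] [CompactSpace Y1] [MeasurableSpace Y1] [BorelSpace Y1]
    [MetricSpace Y0] [CompactSpace Y0] [MeasurableSpace Y0] [BorelSpace Y0]
    [MetricSpace X] [CompactSpace X] [MeasurableSpace X] [BorelSpace X]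
    (μ1X : Measure (Y1 × X)) (μ0X : Measure (Y0 × X))
    [IsProbabilityMeasure μ1X] [IsProbabilityMeasure μ0X]
    (hne : (MSet μ1X μ0X).Nonempty)
    (f : Y1 × Y0 × X → ℝ) (hf : Continuous f) :
    ∃ μ ∈ MSet μ1X μ0X, ∀ μ' ∈ MSet μ1X μ0X, ∫ p, f p ∂μ ≤ ∫ p, f p ∂μ' := by
  have c1 : Continuous (fun p : Y1 × Y0 × X => (p.1, p.2.2)) := by fun_prop
  have c0 : Continuous (fun p : Y1 × Y0 × X => (p.2.1, p.2.2)) := by fun_prop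
  let P1 : ProbabilityMeasure (Y1 × X) := ⟨μ1X, inferInstance⟩
  let P0 : ProbabilityMeasure (Y0 × X) := ⟨μ0X, inferInstance⟩
  let S : Set (ProbabilityMeasure (Y1 × Y0 × X)) :=
    {μ | μ.map c1.measurable.aemeasurable = P1 ∧ μ.map c0.measurable.aemeasurable = P0}
  have hS : ∀ μ : ProbabilityMeasure (Y1 × Y0 × X),
      μ ∈ S ↔ (μ : Measure (Y1 × Y0 × X)) ∈ MSet μ1X μ0X := by
    intro μ
    constructor
    · rintro ⟨a, b⟩
      exact ⟨inferInstance, congrArg ProbabilityMeasure.toMeasure a,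
        congrArg ProbabilityMeasure.toMeasure b⟩
    · rintro ⟨_, a, b⟩
      exact ⟨ProbabilityMeasure.toMeasure_injective a, ProbabilityMeasure.toMeasure_injective b⟩
  have hclosed : IsClosed S :=
    (isClosed_eq (ProbabilityMeasure.continuous_map c1) continuous_const).inter
      (isClosed_eq (ProbabilityMeasure.continuous_map c0) continuous_const)
  have hSne : S.Nonempty := by
    obtain ⟨μ, hμ⟩ := hne
    exact ⟨⟨μ, hμ.1⟩, (hS _).2 hμ⟩
  have hcont : Continuous fun μ : ProbabilityMeasure (Y1 × Y0 × X) =>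
      ∫ p, f p ∂(μ : Measure (Y1 × Y0 × X)) :=
    ProbabilityMeasure.continuous_integral_boundedContinuousFunction
      (BoundedContinuousFunction.mkOfCompact ⟨f, hf⟩)
  obtain ⟨μ, hμ, hmin⟩ := hclosed.isCompact.exists_isMinOn hSne hcont.continuousOn
  refine ⟨μ, (hS μ).1 hμ, fun μ' hμ' => ?_⟩
  exact hmin (show (⟨μ', hμ'.1⟩ : ProbabilityMeasure _) ∈ S from (hS _).2 hμ')

/-- The Tight Bounds Lemma (Lemma B.3): for every direction `q` on the unit sphere there is a
point `θ` of the identified set `Θ_I` with `⟨q, θ⟩ = s(q)`, where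
`s(q) = − inf_{μ ∈ M(μ1X,μ0X)} ∫ qᵀ A⁻¹ m2 dμ` and `A = ∫ m1 dμ0X` is invertible with
inverse `Ainv`. -/
theorem tight_bounds_lemma
    {Y1 Y0 X : Type*}
    [MetricSpace Y1] [CompactSpace Y1] [MeasurableSpace Y1] [BorelSpace Y1]
    [MetricSpace Y0] [CompactSpace Y0] [MeasurableSpace Y0] [BorelSpace Y0]
    [MetricSpace X] [CompactSpace X] [MeasurableSpace X] [BorelSpace X]
    (μ1X : Measure (Y1 × X)) (μ0X : Measure (Y0 × X))
    [IsProbabilityMeasure μ1X] [IsProbabilityMeasure μ0X]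
    (hmarg : μ1X.map Prod.snd = μ0X.map Prod.snd)
    {dθ : ℕ}
    (m1 : Y0 × X → (EuclideanSpace ℝ (Fin dθ) →L[ℝ] EuclideanSpace ℝ (Fin dθ)))
    (hm1 : Continuous m1)
    (m2 : Y1 × Y0 × X → EuclideanSpace ℝ (Fin dθ)) (hm2 : Continuous m2)
    (Ainv : EuclideanSpace ℝ (Fin dθ) →L[ℝ] EuclideanSpace ℝ (Fin dθ))
    (hAinv₁ : ∀ v, Ainv ((∫ q, m1 q ∂μ0X) v) = v)
    (hAinv₂ : ∀ v, (∫ q, m1 q ∂μ0X) (Ainv v) = v) :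
    ∀ q : EuclideanSpace ℝ (Fin dθ), ‖q‖ = 1 →
      ∃ θ ∈ {θ : EuclideanSpace ℝ (Fin dθ) |
          ∃ μ ∈ MSet μ1X μ0X, ∫ p, (m1 (p.2.1, p.2.2)) θ + m2 p ∂μ = 0},
        ⟪q, θ⟫ = - sInf {r : ℝ | ∃ μ ∈ MSet μ1X μ0X, r = ∫ p, ⟪q, Ainv (m2 p)⟫ ∂μ} := by
  intro q _
  haveI : Nonempty (Y1 × X) := nonempty_of_isProbabilityMeasure μ1X
  haveI : Nonempty (Y0 × X) := nonempty_of_isProbabilityMeasure μ0X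
  haveI : Nonempty Y1 := (Nonempty.map Prod.fst ‹Nonempty (Y1 × X)›)
  haveI : Nonempty Y0 := (Nonempty.map Prod.fst ‹Nonempty (Y0 × X)›)
  have hne := MSet_nonempty_aux μ1X μ0X hmarg
  obtain ⟨μ, hμ, hmin⟩ := MSet_exists_min_aux μ1X μ0X hne
    (fun p => ⟪q, Ainv (m2 p)⟫) (by fun_prop)
  have hinf : sInf {r : ℝ | ∃ μ ∈ MSet μ1X μ0X, r = ∫ p, ⟪q, Ainv (m2 p)⟫ ∂μ}
      = ∫ p, ⟪q, Ainv (m2 p)⟫ ∂μ := by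
    refine IsLeast.csInf_eq ⟨⟨μ, hμ, rfl⟩, ?_⟩
    rintro r ⟨μ', hμ', rfl⟩
    exact hmin μ' hμ'
  haveI := hμ.1
  have i2 : Integrable m2 μ :=
    hm2.integrable_of_hasCompactSupport (HasCompactSupport.of_compactSpace _)
  have i1 : Integrable m1 μ0X :=
    hm1.integrable_of_hasCompactSupport (HasCompactSupport.of_compactSpace _)
  have key : ∀ θ, ∫ p, (m1 (p.2.1, p.2.2)) θ ∂μ = (∫ z, m1 z ∂μ0X) θ := by
    intro θ
    rw [ContinuousLinearMap.integral_apply i1]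
    have hc : Continuous fun z => m1 z θ := by fun_prop
    conv_rhs => rw [← hμ.2.2]
    rw [integral_map (by fun_prop) hc.aestronglyMeasurable]
  refine ⟨-Ainv (∫ p, m2 p ∂μ), ⟨μ, hμ, ?_⟩, ?_⟩
  · have hc : Continuous fun p : Y1 × Y0 × X =>
        (m1 (p.2.1, p.2.2)) (-Ainv (∫ p, m2 p ∂μ)) := by fun_prop
    rw [integral_add (hc.integrable_of_hasCompactSupport (HasCompactSupport.of_compactSpace _)) i2,
      key, map_neg, hAinv₂]
    simp
  · rw [hinf, inner_neg_right, ← ContinuousLinearMap.integral_comp_comm _ i2,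
      integral_inner (Ainv.integrable_comp i2)]
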